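/- arXiv:2501.12918 — 4 statements merged into one kernel-verified Lean document; each statement's English description precedes it below -/
import Mathlib

section
/- Let N ≥ 1 be a natural number, c₀ > 0, and let X₁, …, X_N ∈ ℝ³ satisfy |X_i − X_j| ≥ c₀ N^{-1/3} for all i ≠ j. Then there exists a constant C > 0 depending only on c₀ such that for every index i, ∑_{j ≠ i} |X_i − X_j|^{-2} ≤ C N. -/
open Finset

/-- Volume packing: a family of `δ`-separated points in a closed ball of radius `r` has at most
`(1 + 2 r / δ) ^ d` members. -/
theorem card_le_of_separated_of_norm_sub_le {ι E : Type*} [NormedAddCommGroup E] [NormedSpace ℝ E]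
    [FiniteDimensional ℝ E] {δ r : ℝ} (hδ : 0 < δ) (hr : 0 ≤ r) (s : Finset ι) (X : ι → E) (c : E)
    (hsep : ∀ i ∈ s, ∀ j ∈ s, i ≠ j → δ ≤ ‖X i - X j‖) (hball : ∀ j ∈ s, ‖X j - c‖ ≤ r) :
    (s.card : ℝ) ≤ (1 + 2 * r / δ) ^ Module.finrank ℝ E := by
  borelize E
  let μ : MeasureTheory.Measure E := MeasureTheory.Measure.addHaar
  have hdisj : (s : Set ι).PairwiseDisjoint fun j => Metric.ball (X j) (δ / 2) := by
    intro i hi j hj hij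
    apply Metric.ball_disjoint_ball
    rw [dist_eq_norm]
    linarith [hsep i hi j hj hij]
  have hsub : (⋃ j ∈ s, Metric.ball (X j) (δ / 2)) ⊆ Metric.ball c (r + δ / 2) := by
    refine Set.iUnion₂_subset fun j hj => Metric.ball_subset_ball' ?_
    rw [dist_eq_norm]
    linarith [hball j hj]
  have hvol : μ.real (⋃ j ∈ s, Metric.ball (X j) (δ / 2)) ≤ μ.real (Metric.ball c (r + δ / 2)) :=
    MeasureTheory.measureReal_mono hsub
  have hpos : 0 < μ.real (Metric.ball (0 : E) 1) :=
    ENNReal.toReal_pos (Metric.measure_ball_pos μ _ one_pos).ne' MeasureTheory.measure_ball_lt_top.ne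
  rw [MeasureTheory.measureReal_biUnion_finset hdisj fun _ _ => measurableSet_ball] at hvol
  have hvol_ball : ∀ (x : E) {ρ : ℝ}, 0 < ρ → μ.real (Metric.ball x ρ) =
      ρ ^ Module.finrank ℝ E * μ.real (Metric.ball (0 : E) 1) := fun x ρ hρ => by
    rw [MeasureTheory.measureReal_def, MeasureTheory.Measure.addHaar_ball_of_pos μ x hρ,
      ENNReal.toReal_mul, ENNReal.toReal_ofReal (by positivity), MeasureTheory.measureReal_def]
  simp only [hvol_ball _ (half_pos hδ), hvol_ball c (by positivity : 0 < r + δ / 2),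
    sum_const, nsmul_eq_mul, ← mul_assoc] at hvol
  have hcard := le_of_mul_le_mul_right hvol hpos
  rw [← le_div_iff₀ (by positivity), ← div_pow] at hcard
  have hratio : (r + δ / 2) / (δ / 2) = 1 + 2 * r / δ := by
    field_simp
    ring
  rwa [hratio] at hcard

/-- If a finite family of positive reals has at most `(a t) ^ 3` members of size at most `t`, then
its sum of inverse squares is at most `3 a ^ 2` times the cube root of its cardinality. -/
theorem sum_inv_sq_le_of_card_le_cube {ι : Type*} [DecidableEq ι] {a : ℝ} (ha : 0 < a)
    (f : ι → ℝ) (s : Finset ι) (hpos : ∀ j ∈ s, 0 < f j)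
    (hcard : ∀ t ⊆ s, ∀ m ∈ t, (∀ j ∈ t, f j ≤ f m) → (t.card : ℝ) ≤ (a * f m) ^ 3) :
    ∑ j ∈ s, (f j ^ 2)⁻¹ ≤ 3 * a ^ 2 * (s.card : ℝ) ^ (1 / 3 : ℝ) := by
  induction s using Finset.induction_on_max_value f with
  | empty => simp
  | insert m s hm hmax ih =>
    have ih := ih (fun j hj => hpos j (mem_insert_of_mem hj))
      fun t ht => hcard t (ht.trans (subset_insert _ _))
    have hn := hcard _ Subset.rfl m (mem_insert_self _ _) fun j hj => by
      rcases mem_insert.1 hj with rfl | hj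
      exacts [le_rfl, hmax j hj]
    have hfm := hpos m (mem_insert_self _ _)
    rw [sum_insert hm]
    rw [card_insert_of_notMem hm] at hn ⊢
    push_cast at hn ⊢
    set n : ℝ := (s.card : ℝ)
    have hn0 : 0 ≤ n := Nat.cast_nonneg _
    set v := n ^ (1 / 3 : ℝ)
    set u := (n + 1) ^ (1 / 3 : ℝ)
    have hv : 0 ≤ v := by positivity
    have hu : 0 < u := by positivity
    have hv3 : v ^ 3 = n := by
      rw [← Real.rpow_natCast, ← Real.rpow_mul hn0]; norm_num
    have hu3 : u ^ 3 = n + 1 := by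
      rw [← Real.rpow_natCast, ← Real.rpow_mul (by positivity)]; norm_num
    have hvu : v ≤ u := Real.rpow_le_rpow hn0 (by linarith) (by norm_num)
    have huf : u ≤ a * f m := le_of_pow_le_pow_left₀ three_ne_zero (by positivity) (hu3 ▸ hn)
    have hinv : (f m ^ 2)⁻¹ ≤ a ^ 2 * (u ^ 2)⁻¹ := by
      rw [← div_eq_mul_inv, le_div_iff₀ (by positivity), inv_mul_le_iff₀ (by positivity)]
      calc u ^ 2 ≤ (a * f m) ^ 2 := by gcongr
        _ = f m ^ 2 * a ^ 2 := by ring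
    have hdiff : (u ^ 2)⁻¹ ≤ 3 * (u - v) := by
      rw [inv_le_iff_one_le_mul₀ (by positivity)]
      nlinarith [mul_nonneg (sub_nonneg.2 hvu) (sub_nonneg.2 hvu), mul_nonneg hv (sub_nonneg.2 hvu),
        mul_nonneg (sub_nonneg.2 hvu) (by nlinarith : 0 ≤ 2 * u ^ 2 - u * v - v ^ 2)]
    have := mul_le_mul_of_nonneg_left hdiff (sq_nonneg a)
    linarith

/-- Interaction sum estimate `S₂ ≲ N` for well-separated particle centers in `ℝ³`
satisfying `|X_i − X_j| ≥ c₀ N^{-1/3}` for `i ≠ j`. -/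
theorem interaction_sum_S2 (c₀ : ℝ) (hc₀ : 0 < c₀) :
    ∃ C : ℝ, 0 < C ∧ ∀ (N : ℕ), 1 ≤ N →
      ∀ X : Fin N → EuclideanSpace ℝ (Fin 3),
        (∀ i j, i ≠ j → c₀ * (N : ℝ) ^ (-(1 : ℝ) / 3) ≤ ‖X i - X j‖) →
        ∀ i : Fin N,
          ∑ j ∈ Finset.univ.erase i, (‖X i - X j‖ ^ 2)⁻¹ ≤ C * N := by
  refine ⟨27 / c₀ ^ 2, by positivity, fun N hN X hX i => ?_⟩
  have hN0 : (0 : ℝ) < N := by exact_mod_cast hN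
  set u := (N : ℝ) ^ (1 / 3 : ℝ)
  have hu : 0 < u := by positivity
  have hu3 : u ^ 3 = N := by
    rw [← Real.rpow_natCast, ← Real.rpow_mul hN0.le]; norm_num
  have hδu : c₀ * (N : ℝ) ^ (-(1 : ℝ) / 3) = c₀ / u := by
    rw [neg_div, Real.rpow_neg hN0.le, div_eq_mul_inv c₀]
  rw [hδu] at hX
  have hδ : 0 < c₀ / u := by positivity
  have hsum := sum_inv_sq_le_of_card_le_cube (a := 3 / (c₀ / u)) (by positivity)
    (fun j => ‖X i - X j‖) (univ.erase i)
    (fun j hj => hδ.trans_le (hX i j (ne_of_mem_erase hj).symm))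
    (fun t ht m hm hmax => by
      have hfm := hX i m (ne_of_mem_erase (ht hm)).symm
      have hcard := card_le_of_separated_of_norm_sub_le hδ (norm_nonneg (X i - X m)) t X (X i)
        (fun j _ k _ hjk => hX j k hjk) (fun j hj => by rw [norm_sub_rev]; exact hmax j hj)
      rw [finrank_euclideanSpace_fin] at hcard
      refine hcard.trans (pow_le_pow_left₀ (by positivity) ?_ 3)
      rw [div_mul_eq_mul_div, le_div_iff₀ hδ, add_mul, div_mul_cancel₀ _ hδ.ne']
      linarith)
  refine hsum.trans ?_
  have hle : ((univ.erase i).card : ℝ) ^ (1 / 3 : ℝ) ≤ u := by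
    refine Real.rpow_le_rpow (by positivity) ?_ (by norm_num)
    exact_mod_cast (card_le_univ _).trans_eq (Fintype.card_fin N)
  calc _ ≤ 3 * (3 / (c₀ / u)) ^ 2 * u := by gcongr
    _ = 27 / c₀ ^ 2 * N := by
      rw [← hu3]
      field_simp
      norm_num
end

section
/- Let N ≥ 1 be a natural number, c₀ > 0, and let X₁, …, X_N ∈ ℝ³ satisfy |X_i − X_j| ≥ c₀ N^{-1/3} for all i ≠ j. Then there exists a constant C > 0 depending only on c₀ such that for every index i, ∑_{j ≠ i} |X_i − X_j|^{-4} ≤ C N^{4/3}. -/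
open Finset

open MeasureTheory in
/-- In a finite-dimensional normed space, the sum of `‖y‖ ^ (-r)` over a finite `1`-separated family
of points outside the open unit ball is bounded uniformly in the family, provided `r` exceeds the
dimension. -/
theorem exists_sum_norm_rpow_neg_le_of_separated {E : Type*} [NormedAddCommGroup E]
    [NormedSpace ℝ E] [FiniteDimensional ℝ E] {r : ℝ} (hr : (Module.finrank ℝ E : ℝ) < r) :
    ∃ K : ℝ, 0 < K ∧ ∀ {ι : Type*} (s : Finset ι) (Y : ι → E),
      (∀ i ∈ s, ∀ j ∈ s, i ≠ j → 1 ≤ dist (Y i) (Y j)) → (∀ j ∈ s, 1 ≤ ‖Y j‖) →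
        ∑ j ∈ s, ‖Y j‖ ^ (-r) ≤ K := by
  borelize E
  let μ : Measure E := Measure.addHaar
  have hr0 : 0 ≤ r := (Nat.cast_nonneg _).trans hr.le
  have hint : Integrable (fun x : E ↦ (1 + ‖x‖) ^ (-r)) μ := integrable_one_add_norm hr
  set I := ∫ x : E, (1 + ‖x‖) ^ (-r) ∂μ
  set v := μ.real (Metric.ball (0 : E) (1 / 2))
  have hv : 0 < v :=
    ENNReal.toReal_pos (Metric.measure_ball_pos μ _ (by norm_num)).ne' measure_ball_lt_top.ne
  have hI : 0 ≤ I := integral_nonneg fun x ↦ by positivity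
  refine ⟨(5 / 2 : ℝ) ^ r * I / v + 1, by positivity, fun {ι} s Y hsep hY ↦ ?_⟩
  have hball : ∀ j ∈ s, ‖Y j‖ ^ (-r) * v ≤
      (5 / 2 : ℝ) ^ r * ∫ x in Metric.ball (Y j) (1 / 2), (1 + ‖x‖) ^ (-r) ∂μ := by
    intro j hj
    have hvj : μ.real (Metric.ball (Y j) (1 / 2)) = v := by
      simp only [v, Measure.real, Measure.addHaar_ball_center]
    rw [← integral_const_mul, mul_comm, ← hvj, ← smul_eq_mul, ← setIntegral_const]
    refine setIntegral_mono_on (integrableOn_const measure_ball_lt_top.ne)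
      (hint.const_mul _).integrableOn measurableSet_ball fun x hx ↦ ?_
    have hx' : ‖x‖ ≤ ‖Y j‖ + 1 / 2 := by
      have h := norm_le_norm_add_norm_sub' x (Y j)
      rw [mem_ball_iff_norm] at hx
      linarith
    have hYj := hY j hj
    calc ‖Y j‖ ^ (-r) = (5 / 2 : ℝ) ^ r * (5 / 2 * ‖Y j‖) ^ (-r) := by
          rw [Real.mul_rpow (by norm_num) (norm_nonneg _), ← mul_assoc,
            ← Real.rpow_add (by norm_num), add_neg_cancel, Real.rpow_zero, one_mul]
      _ ≤ (5 / 2 : ℝ) ^ r * (1 + ‖x‖) ^ (-r) := by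
          gcongr ?_ * ?_
          exact Real.rpow_le_rpow_of_nonpos (by positivity) (by linarith) (by linarith)
  have hdisj : (s : Set ι).Pairwise
      (Function.onFun Disjoint fun j ↦ Metric.ball (Y j) (1 / 2)) := fun i hi j hj hij ↦
    Metric.ball_disjoint_ball (by rw [add_halves]; exact hsep i hi j hj hij)
  have hsum : (∑ j ∈ s, ‖Y j‖ ^ (-r)) * v ≤ (5 / 2 : ℝ) ^ r * I := by
    rw [sum_mul]
    refine (sum_le_sum hball).trans ?_
    rw [← mul_sum, ← integral_biUnion_finset s (fun _ _ ↦ measurableSet_ball) hdisj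
      fun _ _ ↦ hint.integrableOn]
    gcongr
    exact setIntegral_le_integral hint (.of_forall fun x ↦ by positivity)
  rw [← le_div_iff₀ hv] at hsum
  linarith

/-- Interaction sum estimate `S₄ ≲ N^{4/3}` for well-separated particle centers in `ℝ³`
satisfying `|X_i − X_j| ≥ c₀ N^{-1/3}` for `i ≠ j`. -/
theorem interaction_sum_S4 (c₀ : ℝ) (hc₀ : 0 < c₀) :
    ∃ C : ℝ, 0 < C ∧ ∀ (N : ℕ), 1 ≤ N →
      ∀ X : Fin N → EuclideanSpace ℝ (Fin 3),
        (∀ i j, i ≠ j → c₀ * (N : ℝ) ^ (-(1 : ℝ) / 3) ≤ ‖X i - X j‖) →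
        ∀ i : Fin N,
          ∑ j ∈ Finset.univ.erase i, (‖X i - X j‖ ^ 4)⁻¹ ≤ C * (N : ℝ) ^ ((4 : ℝ) / 3) := by
  obtain ⟨K, hK, hsum⟩ := exists_sum_norm_rpow_neg_le_of_separated
    (E := EuclideanSpace ℝ (Fin 3)) (r := 4) (by simp; norm_num)
  refine ⟨K * (c₀ ^ 4)⁻¹, by positivity, fun N hN X hX i ↦ ?_⟩
  have hN0 : (0 : ℝ) < N := by exact_mod_cast hN
  set δ := c₀ * (N : ℝ) ^ (-(1 : ℝ) / 3) with hδ
  have hδ0 : 0 < δ := by positivity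
  have hδ4 : (δ ^ 4)⁻¹ = (c₀ ^ 4)⁻¹ * (N : ℝ) ^ ((4 : ℝ) / 3) := by
    rw [hδ, mul_pow, mul_inv, ← Real.rpow_natCast ((N : ℝ) ^ _), ← Real.rpow_mul hN0.le,
      ← Real.rpow_neg hN0.le]
    norm_num
  have hscale (x : EuclideanSpace ℝ (Fin 3)) : ‖δ⁻¹ • x‖ = δ⁻¹ * ‖x‖ := by
    rw [norm_smul, Real.norm_of_nonneg (inv_nonneg.2 hδ0.le)]
  have hone {t : ℝ} (ht : δ ≤ t) : 1 ≤ δ⁻¹ * t := by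
    rwa [inv_mul_eq_div, one_le_div hδ0]
  have key := hsum (univ.erase i) (fun j ↦ δ⁻¹ • (X i - X j))
    (fun j _ k _ hjk ↦ by
      rw [dist_eq_norm, ← smul_sub, sub_sub_sub_cancel_left, hscale]
      exact hone (hX k j hjk.symm))
    (fun j hj ↦ by
      rw [hscale]
      exact hone (hX i j (ne_of_mem_erase hj).symm))
  calc ∑ j ∈ univ.erase i, (‖X i - X j‖ ^ 4)⁻¹
      = (∑ j ∈ univ.erase i, ‖δ⁻¹ • (X i - X j)‖ ^ (-4 : ℝ)) * (δ ^ 4)⁻¹ := by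
        rw [sum_mul]
        refine sum_congr rfl fun j _ ↦ ?_
        rw [hscale, Real.rpow_neg (by positivity), Real.rpow_ofNat, mul_pow, mul_inv, inv_pow,
          inv_inv]
        field_simp
    _ ≤ K * (δ ^ 4)⁻¹ := by gcongr
    _ = K * (c₀ ^ 4)⁻¹ * (N : ℝ) ^ ((4 : ℝ) / 3) := by rw [hδ4, mul_assoc]
end

section
/- Let Φ : ℝ³ \ {0} → ℝ^{3×3} be the Oseen tensor, Φ(x) = (1/(8π)) ( |x|^{-1} Id + |x|^{-3} x ⊗ x ). There exists a constant C > 0 such that for all a, b ∈ ℝ³ \ {0} with |a − b| ≤ |a|/2, the second derivatives satisfy ‖D²Φ(a) − D²Φ(b)‖ ≤ C |a − b| |a|^{-4}. -/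
open Real

attribute [local instance] Matrix.normedAddCommGroup Matrix.normedSpace

/-- The Oseen tensor `Φ(x) = (1/(8π)) ( |x|⁻¹ Id + |x|⁻³ x ⊗ x )`, the fundamental
solution of the Stokes equations in `ℝ³` (defined by the same formula on all of `ℝ³`,
with the junk value `0⁻¹ = 0` at the origin). -/
noncomputable def oseenTensor (x : EuclideanSpace ℝ (Fin 3)) : Matrix (Fin 3) (Fin 3) ℝ :=
  (8 * Real.pi)⁻¹ • (‖x‖⁻¹ • (1 : Matrix (Fin 3) (Fin 3) ℝ) +
    (‖x‖ ^ 3)⁻¹ • Matrix.of fun i j => x i * x j)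

section Homogeneous

variable {E F : Type*} [NormedAddCommGroup E] [NormedSpace ℝ E]
  [NormedAddCommGroup F] [NormedSpace ℝ F]

/-- Iterated derivatives of a rescaled function, with no regularity assumption. -/
theorem iteratedFDeriv_comp_smul (f : E → F) (c : ℝ) (i : ℕ) :
    iteratedFDeriv ℝ i (fun y => f (c • y)) = fun x => c ^ i • iteratedFDeriv ℝ i f (c • x) := by
  induction i with
  | zero => ext x; simp
  | succ i ih =>
    ext x m
    have h : fderiv ℝ (fun y => c ^ i • iteratedFDeriv ℝ i f (c • y)) x
        = c ^ (i + 1) • fderiv ℝ (iteratedFDeriv ℝ i f) (c • x) := by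
      refine (congrFun (fderiv_const_smul_field (𝕜 := ℝ) (c ^ i)
        (f := fun y => iteratedFDeriv ℝ i f (c • y))) x).trans ?_
      rw [Pi.smul_apply, fderiv_comp_smul, smul_smul, pow_succ]
    rw [iteratedFDeriv_succ_apply_left, ih, h]
    rfl

/-- The `i`-th derivative of a function which is positively homogeneous of degree `-1`
is positively homogeneous of degree `-(1 + i)`. -/
theorem norm_iteratedFDeriv_of_homogeneous {f : E → F}
    (hf : ∀ c : ℝ, 0 < c → ∀ x, f (c • x) = c⁻¹ • f x) (i : ℕ) {c : ℝ} (hc : 0 < c) (x : E) :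
    ‖iteratedFDeriv ℝ i f (c • x)‖ = (c ^ (i + 1))⁻¹ * ‖iteratedFDeriv ℝ i f x‖ := by
  have h : c ^ i • iteratedFDeriv ℝ i f (c • x) = c⁻¹ • iteratedFDeriv ℝ i f x := by
    rw [← congrFun (iteratedFDeriv_comp_smul f c i) x, funext (hf c hc)]
    clear hf
    induction i generalizing x with
    | zero => ext; simp
    | succ i ih =>
      ext m
      rw [iteratedFDeriv_succ_apply_left, funext ih]
      have h := congrFun (fderiv_const_smul_field (𝕜 := ℝ) c⁻¹ (f := iteratedFDeriv ℝ i f)) x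
      exact congrArg (fun L => L (m 0) (Fin.tail m)) h
  have h' := congrArg norm h
  rw [norm_smul, norm_smul, norm_pow, norm_inv, Real.norm_of_nonneg hc.le] at h'
  rw [pow_succ, mul_inv, mul_assoc, ← h', inv_mul_cancel_left₀ (pow_ne_zero _ hc.ne')]

/-- Derivative bound for a smooth function that is homogeneous of degree `-1`. -/
theorem exists_norm_iteratedFDeriv_le_of_homogeneous [ProperSpace E] {f : E → F}
    (hf : ∀ c : ℝ, 0 < c → ∀ x, f (c • x) = c⁻¹ • f x) (i : ℕ)
    (hd : ∀ x ≠ 0, ContDiffAt ℝ i f x) :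
    ∃ C : ℝ, 0 < C ∧ ∀ x ≠ 0, ‖iteratedFDeriv ℝ i f x‖ ≤ C * (‖x‖ ^ (i + 1))⁻¹ := by
  have hc : ContinuousOn (iteratedFDeriv ℝ i f) (Metric.sphere 0 1) := fun x hx =>
    ((hd x (ne_zero_of_mem_unit_sphere ⟨x, hx⟩)).continuousAt_iteratedFDeriv
      le_rfl).continuousWithinAt
  obtain ⟨C, hC⟩ := (isCompact_sphere (0 : E) 1).exists_bound_of_continuousOn hc
  refine ⟨max C 1, by positivity, fun x hx => ?_⟩
  have hx' : 0 < ‖x‖ := norm_pos_iff.2 hx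
  have h := norm_iteratedFDeriv_of_homogeneous hf i hx' (‖x‖⁻¹ • x)
  rw [smul_inv_smul₀ hx'.ne'] at h
  rw [h, mul_comm]
  gcongr
  refine (hC _ ?_).trans (le_max_left _ _)
  simp [norm_smul, hx'.ne']

/-- Mean-value estimate for the `i`-th derivative of a smooth function that is homogeneous of
degree `-1`. -/
theorem exists_norm_iteratedFDeriv_sub_le_of_homogeneous [ProperSpace E] {f : E → F}
    (hf : ∀ c : ℝ, 0 < c → ∀ x, f (c • x) = c⁻¹ • f x) (i : ℕ)
    (hd : ∀ x ≠ 0, ContDiffAt ℝ (i + 1 : ℕ) f x) :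
    ∃ C : ℝ, 0 < C ∧ ∀ a b : E, a ≠ 0 → ‖a - b‖ ≤ ‖a‖ / 2 →
      ‖iteratedFDeriv ℝ i f a - iteratedFDeriv ℝ i f b‖
        ≤ C * ‖a - b‖ * (‖a‖ ^ (i + 2))⁻¹ := by
  obtain ⟨C, hC, hbound⟩ := exists_norm_iteratedFDeriv_le_of_homogeneous hf (i + 1) hd
  refine ⟨C * 2 ^ (i + 2), by positivity, fun a b ha hab => ?_⟩
  have ha' : 0 < ‖a‖ := norm_pos_iff.2 ha
  have hball : ∀ x ∈ Metric.closedBall a (‖a‖ / 2), ‖a‖ / 2 ≤ ‖x‖ := fun x hx => by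
    rw [mem_closedBall_iff_norm'] at hx
    linarith [norm_sub_norm_le a x]
  have hne : ∀ x ∈ Metric.closedBall a (‖a‖ / 2), x ≠ 0 := fun x hx =>
    norm_pos_iff.1 ((half_pos ha').trans_le (hball x hx))
  have key := (convex_closedBall a (‖a‖ / 2)).norm_image_sub_le_of_norm_fderiv_le (𝕜 := ℝ)
    (f := iteratedFDeriv ℝ i f) (C := C * ((‖a‖ / 2) ^ (i + 2))⁻¹)
    (x := b) (y := a)
    (fun x hx => (hd x (hne x hx)).differentiableAt_iteratedFDeriv
      (by exact_mod_cast Nat.lt_succ_self i))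
    (fun x hx => by
      rw [norm_fderiv_iteratedFDeriv]
      refine (hbound x (hne x hx)).trans ?_
      gcongr
      exact hball x hx)
    (mem_closedBall_iff_norm'.2 hab) (Metric.mem_closedBall_self (by positivity))
  refine key.trans_eq ?_
  rw [div_pow, inv_div]
  ring

end Homogeneous

theorem oseenTensor_smul {c : ℝ} (hc : 0 < c) (x : EuclideanSpace ℝ (Fin 3)) :
    oseenTensor (c • x) = c⁻¹ • oseenTensor x := by
  ext i j
  simp only [oseenTensor, norm_smul, Real.norm_of_nonneg hc.le, Matrix.smul_apply,
    Matrix.add_apply, Matrix.of_apply, PiLp.smul_apply, smul_eq_mul]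
  field_simp

theorem contDiffAt_oseenTensor {n : WithTop ℕ∞} {x : EuclideanSpace ℝ (Fin 3)} (hx : x ≠ 0) :
    ContDiffAt ℝ n oseenTensor x := by
  have hnorm : ContDiffAt ℝ n (fun y : EuclideanSpace ℝ (Fin 3) => ‖y‖) x := contDiffAt_norm ℝ hx
  have hx' : ‖x‖ ≠ 0 := norm_ne_zero_iff.2 hx
  have hcoord (i : Fin 3) : ContDiffAt ℝ n (fun y : EuclideanSpace ℝ (Fin 3) => y i) x :=
    (EuclideanSpace.proj i : EuclideanSpace ℝ (Fin 3) →L[ℝ] ℝ).contDiff.contDiffAt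
  refine contDiffAt_pi.2 fun i => contDiffAt_pi.2 fun j => ?_
  exact contDiffAt_const.mul (((hnorm.inv hx').mul contDiffAt_const).add
    (((hnorm.pow 3).inv (pow_ne_zero 3 hx')).mul ((hcoord i).mul (hcoord j))))

/-- Mean-value kernel estimate for the second derivatives of the Oseen tensor:
`‖D²Φ(a) − D²Φ(b)‖ ≤ C |a − b| |a|⁻⁴` whenever `a, b ≠ 0` and `|a − b| ≤ |a|/2`. -/
theorem oseenTensor_second_derivative_CZ_estimate :
    ∃ C : ℝ, 0 < C ∧
      ∀ a b : EuclideanSpace ℝ (Fin 3), a ≠ 0 → b ≠ 0 → ‖a - b‖ ≤ ‖a‖ / 2 →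
        ‖iteratedFDeriv ℝ 2 oseenTensor a - iteratedFDeriv ℝ 2 oseenTensor b‖
          ≤ C * ‖a - b‖ * (‖a‖ ^ 4)⁻¹ := by
  obtain ⟨C, hC, h⟩ := exists_norm_iteratedFDeriv_sub_le_of_homogeneous
    (fun _ hc x => oseenTensor_smul hc x) 2 (fun _ hx => contDiffAt_oseenTensor hx)
  exact ⟨C, hC, fun a b ha _ hab => h a b ha hab⟩
end

section
/- Let E be a metric space equipped with its Borel σ-algebra, let μ, ν be probability measures on E, let γ be a coupling of μ and ν, and let m : E → [0,1] be measurable. Define the lifted probability measure μ̂ on E × ℝ by ∫ φ dμ̂ = ∫_E ( m(z) φ(z, 1) + (1 − m(z)) φ(z, −1) ) dμ(z) for bounded measurable φ, and define ν̂ analogously from ν. Then there exists a coupling γ̂ of μ̂ and ν̂ on (E × ℝ) × (E × ℝ) such that ∫ ( d(z₁, z₂)² + |s₁ − s₂|² ) dγ̂((z₁, s₁), (z₂, s₂)) ≤ ∫ d(z₁, z₂)² dγ + 4 ∫ |m(z₁) − m(z₂)| dγ. -/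
open MeasureTheory

/-- The coupling of two spin-lifted measures over `γ` which, over `z`, puts the maximal possible
mass on the diagonal of `{±1} × {±1}`. -/
noncomputable def spinCoupling {E : Type*} [MeasurableSpace E] (γ : Measure (E × E))
    (m : E → ℝ) : Measure ((E × ℝ) × (E × ℝ)) :=
  (γ.withDensity fun z => ENNReal.ofReal (min (m z.1) (m z.2))).map
      (Prod.map (·, 1) (·, 1)) +
    (γ.withDensity fun z => ENNReal.ofReal (m z.1 - m z.2)).map (Prod.map (·, 1) (·, -1)) +
    (γ.withDensity fun z => ENNReal.ofReal (m z.2 - m z.1)).map (Prod.map (·, -1) (·, 1)) +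
    (γ.withDensity fun z => ENNReal.ofReal (1 - max (m z.1) (m z.2))).map
      (Prod.map (·, -1) (·, -1))

theorem lintegral_spinCoupling {E : Type*} [MeasurableSpace E] (γ : Measure (E × E))
    {m : E → ℝ} (hm : Measurable m) {F : (E × ℝ) × (E × ℝ) → ENNReal} (hF : Measurable F) :
    ∫⁻ q, F q ∂spinCoupling γ m =
      ∫⁻ z, (ENNReal.ofReal (min (m z.1) (m z.2)) * F ((z.1, 1), (z.2, 1)) +
        ENNReal.ofReal (m z.1 - m z.2) * F ((z.1, 1), (z.2, -1)) +
        ENNReal.ofReal (m z.2 - m z.1) * F ((z.1, -1), (z.2, 1)) +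
        ENNReal.ofReal (1 - max (m z.1) (m z.2)) * F ((z.1, -1), (z.2, -1))) ∂γ := by
  have key (w : E × E → ℝ) (hw : Measurable w) (s t : ℝ) :
      ∫⁻ q, F q ∂(γ.withDensity fun z => ENNReal.ofReal (w z)).map (Prod.map (·, s) (·, t)) =
        ∫⁻ z, ENNReal.ofReal (w z) * F ((z.1, s), (z.2, t)) ∂γ := by
    rw [lintegral_map hF (by fun_prop),
      lintegral_withDensity_eq_lintegral_mul _ (by fun_prop) (by fun_prop)]
    rfl
  simp only [spinCoupling, lintegral_add_measure]
  rw [key (fun z => min (m z.1) (m z.2)) (by fun_prop), key (fun z => m z.1 - m z.2) (by fun_prop),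
    key (fun z => m z.2 - m z.1) (by fun_prop),
    key (fun z => 1 - max (m z.1) (m z.2)) (by fun_prop),
    lintegral_add_right _ (by fun_prop), lintegral_add_right _ (by fun_prop),
    lintegral_add_right _ (by fun_prop)]

theorem ofReal_min_add_ofReal_sub {a b : ℝ} (hb : 0 ≤ b) :
    ENNReal.ofReal (min a b) + ENNReal.ofReal (a - b) = ENNReal.ofReal a := by
  rcases le_total a b with h | h
  · rw [min_eq_left h, ENNReal.ofReal_of_nonpos (sub_nonpos.2 h), add_zero]
  · rw [min_eq_right h, ← ENNReal.ofReal_add hb (sub_nonneg.2 h), add_sub_cancel]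

theorem ofReal_sub_add_ofReal_one_sub_max {a b : ℝ} (hb : b ≤ 1) :
    ENNReal.ofReal (b - a) + ENNReal.ofReal (1 - max a b) = ENNReal.ofReal (1 - a) := by
  rcases le_total a b with h | h
  · rw [max_eq_right h, ← ENNReal.ofReal_add (sub_nonneg.2 h) (sub_nonneg.2 hb)]
    ring_nf
  · rw [max_eq_left h, ENNReal.ofReal_of_nonpos (sub_nonpos.2 h), zero_add]

theorem ofReal_sub_add_ofReal_sub (a b : ℝ) :
    ENNReal.ofReal (a - b) + ENNReal.ofReal (b - a) = ENNReal.ofReal |a - b| := by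
  rcases le_total a b with h | h
  · rw [ENNReal.ofReal_of_nonpos (sub_nonpos.2 h), zero_add, abs_sub_comm,
      abs_of_nonneg (sub_nonneg.2 h)]
  · rw [ENNReal.ofReal_of_nonpos (sub_nonpos.2 h), add_zero, abs_of_nonneg (sub_nonneg.2 h)]

/-- Integrals of functions of the positions alone, which need not be measurable. -/
theorem lintegral_spinCoupling_of_positions {E : Type*} [MeasurableSpace E] (γ : Measure (E × E))
    {m : E → ℝ} (hm : Measurable m) (hm01 : ∀ z, m z ∈ Set.Icc (0 : ℝ) 1)
    (f : E × E → ENNReal) :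
    ∫⁻ q, f (q.1.1, q.2.1) ∂spinCoupling γ m = ∫⁻ z, f z ∂γ := by
  have emb (s t : ℝ) : MeasurableEmbedding
      (Prod.map (·, s) (·, t) : E × E → (E × ℝ) × (E × ℝ)) :=
    (measurableEmbedding_prod_mk_right s).prodMap (measurableEmbedding_prod_mk_right t)
  simp only [spinCoupling, lintegral_add_measure, (emb _ _).lintegral_map, Prod.map_fst,
    Prod.map_snd, Prod.mk.eta]
  rw [← lintegral_add_measure, ← lintegral_add_measure, ← lintegral_add_measure,
    ← withDensity_add_right _ (by fun_prop), ← withDensity_add_right _ (by fun_prop),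
    ← withDensity_add_right _ (by fun_prop)]
  have h1 (z : E × E) : ENNReal.ofReal (min (m z.1) (m z.2)) + ENNReal.ofReal (m z.1 - m z.2) +
      ENNReal.ofReal (m z.2 - m z.1) + ENNReal.ofReal (1 - max (m z.1) (m z.2)) = 1 := by
    rw [add_assoc, ofReal_min_add_ofReal_sub (hm01 _).1,
      ofReal_sub_add_ofReal_one_sub_max (hm01 _).2,
      ← ENNReal.ofReal_add (hm01 _).1 (sub_nonneg.2 (hm01 _).2), add_sub_cancel,
      ENNReal.ofReal_one]
  conv_rhs => rw [← withDensity_one (μ := γ)]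
  congr 2
  exact funext h1

/-- Spin lifting of a coupling: given a coupling `γ` of probability measures `μ, ν` on a
metric space `E` and a measurable `m : E → [0,1]`, lift `μ` and `ν` to measures `μ̂, ν̂`
on `E × ℝ` by attaching a `{±1}`-valued spin with law `(m(z), 1 − m(z))` at each point.
Then there is a coupling `γ̂` of `μ̂` and `ν̂` with quadratic cost bounded by
`∫ d(z₁,z₂)² dγ + 4 ∫ |m(z₁) − m(z₂)| dγ`. -/
theorem spin_lifted_coupling {E : Type*} [MetricSpace E] [MeasurableSpace E] [BorelSpace E]
    (μ ν : Measure E) [IsProbabilityMeasure μ] [IsProbabilityMeasure ν]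
    (γ : Measure (E × E)) (hγ₁ : γ.map Prod.fst = μ) (hγ₂ : γ.map Prod.snd = ν)
    (m : E → ℝ) (hm : Measurable m) (hm01 : ∀ z, m z ∈ Set.Icc (0 : ℝ) 1)
    (μhat νhat : Measure (E × ℝ))
    (hμhat : ∀ φ : E × ℝ → ENNReal, Measurable φ →
      ∫⁻ q, φ q ∂μhat
        = ∫⁻ z, (ENNReal.ofReal (m z) * φ (z, 1)
            + ENNReal.ofReal (1 - m z) * φ (z, -1)) ∂μ)
    (hνhat : ∀ φ : E × ℝ → ENNReal, Measurable φ →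
      ∫⁻ q, φ q ∂νhat
        = ∫⁻ z, (ENNReal.ofReal (m z) * φ (z, 1)
            + ENNReal.ofReal (1 - m z) * φ (z, -1)) ∂ν) :
    ∃ γhat : Measure ((E × ℝ) × (E × ℝ)),
      γhat.map Prod.fst = μhat ∧ γhat.map Prod.snd = νhat ∧
      (∫⁻ q, (edist q.1.1 q.2.1 ^ 2 + edist q.1.2 q.2.2 ^ 2) ∂γhat)
        ≤ (∫⁻ q, edist q.1 q.2 ^ 2 ∂γ)
          + 4 * ∫⁻ q, ENNReal.ofReal |m q.1 - m q.2| ∂γ := by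
  refine ⟨spinCoupling γ m, ?_, ?_, ?_⟩
  · refine Measure.ext_of_lintegral _ fun φ hφ => ?_
    rw [lintegral_map hφ measurable_fst, lintegral_spinCoupling γ hm (by fun_prop), hμhat φ hφ,
      ← hγ₁, lintegral_map (by fun_prop) measurable_fst]
    refine lintegral_congr fun z => ?_
    rw [← ofReal_min_add_ofReal_sub (a := m z.1) (hm01 z.2).1,
      ← ofReal_sub_add_ofReal_one_sub_max (a := m z.1) (hm01 z.2).2]
    ring
  · refine Measure.ext_of_lintegral _ fun φ hφ => ?_
    rw [lintegral_map hφ measurable_snd, lintegral_spinCoupling γ hm (by fun_prop), hνhat φ hφ,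
      ← hγ₂, lintegral_map (by fun_prop) measurable_snd]
    refine lintegral_congr fun z => ?_
    rw [← ofReal_min_add_ofReal_sub (a := m z.2) (hm01 z.1).1,
      ← ofReal_sub_add_ofReal_one_sub_max (a := m z.2) (hm01 z.1).2,
      min_comm (m z.2), max_comm (m z.2)]
    ring
  · rw [lintegral_add_right _ (by fun_prop),
      lintegral_spinCoupling_of_positions γ hm hm01 fun z => edist z.1 z.2 ^ 2,
      lintegral_spinCoupling γ hm (by fun_prop), ← lintegral_const_mul _ (by fun_prop)]
    refine add_le_add le_rfl (lintegral_mono fun z => le_of_eq ?_)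
    have h4 : edist (1 : ℝ) (-1) ^ 2 = 4 := by
      rw [edist_dist, Real.dist_eq, ← ENNReal.ofReal_pow (abs_nonneg _)]
      norm_num
    simp only [edist_self, edist_comm (-1 : ℝ) 1, h4, ← ofReal_sub_add_ofReal_sub]
    ring
end
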